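/- Let S be Hermitian positive-definite and N = diag(I_D, -I_D). Then N·S is diagonalizable with all eigenvalues real and nonzero, and every eigenvector x of N·S satisfies x† N x ≠ 0. -/

import Mathlib

open Matrix
open scoped ComplexOrder

open scoped MatrixOrder Matrix.Norms.L2Operator in
lemma exists_factor {n : Type*} [Fintype n] [DecidableEq n] (S : Matrix n n ℂ) (hS : S.PosDef) :
    ∃ B : Matrix n n ℂ, S = Bᴴ * B := by
  obtain ⟨y, hy⟩ := CStarAlgebra.nonneg_iff_eq_star_mul_self.mp hS.posSemidef.nonneg
  exact ⟨y, hy⟩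

theorem stmt_17 {D : ℕ} (hD : 0 < D)
    (S N : Matrix (Fin D ⊕ Fin D) (Fin D ⊕ Fin D) ℂ)
    (hS : S.PosDef)
    (hN : N = Matrix.fromBlocks 1 0 0 (-1)) :
    (∃ (P : Matrix (Fin D ⊕ Fin D) (Fin D ⊕ Fin D) ℂ)
        (d : Fin D ⊕ Fin D → ℝ), IsUnit P.det ∧ (∀ i, d i ≠ 0) ∧
        N * S = P * Matrix.diagonal (fun i => (d i : ℂ)) * P⁻¹) ∧
      ∀ (ω : ℂ) (x : Fin D ⊕ Fin D → ℂ), x ≠ 0 →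
        (N * S).mulVec x = ω • x → star x ⬝ᵥ N.mulVec x ≠ 0 := by
  have hNN : N * N = 1 := by
    subst hN
    simp [Matrix.fromBlocks_multiply]
  have hNH : Nᴴ = N := by
    subst hN
    simp [Matrix.fromBlocks_conjTranspose]
  constructor
  · obtain ⟨B, hB⟩ := exists_factor S hS
    have hSdet : S.det ≠ 0 := hS.det_pos.ne'
    have hBdet : B.det ≠ 0 := by
      intro h
      apply hSdet
      rw [hB, det_mul, h, mul_zero]
    have hBu : IsUnit B.det := isUnit_iff_ne_zero.mpr hBdet
    have hNdet : N.det ≠ 0 := by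
      intro h
      have := congrArg det hNN
      rw [det_mul, h] at this
      simp at this
    have hH : (B * N * Bᴴ).IsHermitian := by
      simp [Matrix.IsHermitian, Matrix.conjTranspose_mul, hNH, Matrix.mul_assoc]
    have hHdet : (B * N * Bᴴ).det ≠ 0 := by
      rw [det_mul, det_mul, det_conjTranspose]
      exact mul_ne_zero (mul_ne_zero hBdet hNdet) (star_ne_zero.mpr hBdet)
    have hsp := hH.spectral_theorem
    rw [Unitary.conjStarAlgAut_apply] at hsp
    have hdiag : (diagonal (RCLike.ofReal ∘ hH.eigenvalues) :
        Matrix (Fin D ⊕ Fin D) (Fin D ⊕ Fin D) ℂ)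
        = diagonal (fun i => (hH.eigenvalues i : ℂ)) := by
      congr 1
    rw [hdiag] at hsp
    have hUU : (star (hH.eigenvectorUnitary : Matrix (Fin D ⊕ Fin D) (Fin D ⊕ Fin D) ℂ)) * (hH.eigenvectorUnitary : Matrix (Fin D ⊕ Fin D) (Fin D ⊕ Fin D) ℂ) = 1 :=
      Unitary.coe_star_mul_self _
    have hd : ∀ i, hH.eigenvalues i ≠ 0 := by
      intro i hi
      apply hHdet
      rw [hH.det_eq_prod_eigenvalues]
      exact Finset.prod_eq_zero (Finset.mem_univ i) (by simp [hi])
    have hinv : (B⁻¹ * (hH.eigenvectorUnitary : Matrix (Fin D ⊕ Fin D) (Fin D ⊕ Fin D) ℂ))⁻¹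
        = star (hH.eigenvectorUnitary : Matrix (Fin D ⊕ Fin D) (Fin D ⊕ Fin D) ℂ) * B := by
      apply Matrix.inv_eq_left_inv
      rw [Matrix.mul_assoc, ← Matrix.mul_assoc B, Matrix.mul_nonsing_inv _ hBu, Matrix.one_mul, hUU]
    refine ⟨B⁻¹ * (hH.eigenvectorUnitary : Matrix (Fin D ⊕ Fin D) (Fin D ⊕ Fin D) ℂ), hH.eigenvalues, ?_, hd, ?_⟩
    · rw [det_mul]
      refine IsUnit.mul ?_ ?_
      · exact Matrix.isUnit_nonsing_inv_det _ hBu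
      · exact Matrix.isUnit_det_of_left_inverse hUU
    · rw [hinv]
      calc N * S = B⁻¹ * (B * N * Bᴴ) * B := by
            rw [hB, Matrix.mul_assoc B, ← Matrix.mul_assoc B⁻¹, Matrix.nonsing_inv_mul _ hBu,
              Matrix.one_mul, Matrix.mul_assoc]
        _ = _ := by
            refine (congrArg (fun M => B⁻¹ * M * B) hsp).trans ?_
            simp only [Matrix.mul_assoc]
  · intro ω x hx h h0
    have h1 : S.mulVec x = ω • N.mulVec x := by
      rw [← Matrix.mulVec_smul, ← h, Matrix.mulVec_mulVec, ← Matrix.mul_assoc, hNN, Matrix.one_mul]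
    have h2 := hS.dotProduct_mulVec_pos hx
    rw [h1, dotProduct_smul, h0, smul_zero] at h2
    exact lt_irrefl _ h2
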